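/- arXiv:1802.05784 — 5 statements merged into one kernel-verified Lean document; each statement's English description precedes it below -/
import Mathlib

section
/- Quantitative surjectivity four lemma: Consider a commutative diagram whose top row f₁ : A₁ → A₂, f₂ : A₂ → A₃, f₃ : A₃ → A₄ is an exact sequence of homomorphisms of finitely generated groups, whose bottom row m₁ : V₁ → V₂, m₂ : V₂ → V₃, m₃ : V₃ → V₄ is an exact sequence of linear maps of finite-dimensional normed real vector spaces, and whose vertical maps φᵢ : Aᵢ → Vᵢ are homomorphisms into the additive groups of the Vᵢ satisfying mᵢ ∘ φᵢ = φ_{i+1} ∘ fᵢ for i = 1, 2, 3. Assume m₁ and m₃ have operator norm at most 1, and let τ ≥ 0 be a constant such that every v in the image of m₂ has a preimage u ∈ V₂ with ‖u‖ ≤ τ‖v‖. If φ₁ is C₁-surjective, φ₃ is C₃-surjective, and φ₄ is C₄-injective, then φ₂ is (C₁ + 3τ · C₃^{rk m₃ + 1} · C₄)-surjective, where rk m denotes the dimension of the image of a linear map m. -/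
/-- A map `h : A → V` to a normed vector space is `C`-injective if every closed ball
of radius 1 in `V` has preimage containing at most `C` elements. -/
def CInjective {A V : Type*} [NormedAddCommGroup V] (h : A → V) (C : ℝ) : Prop :=
  ∀ x : V, ∀ S : Finset A, (∀ a ∈ S, h a ∈ Metric.closedBall x 1) → (S.card : ℝ) ≤ C

/-- A map `h : A → V` to a normed vector space is `C`-surjective if every point of `V`
is within distance `C` of the image of `h`. -/
def CSurjective {A V : Type*} [NormedAddCommGroup V] (h : A → V) (C : ℝ) : Prop :=
  ∀ v : V, ∃ a : A, ‖h a - v‖ ≤ C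

open MeasureTheory in
/-- Points whose unit balls overlap at most `C`-fold and which lie in a ball of radius `T`
number at most `C * (T + 1) ^ dim E`. -/
theorem card_le_of_unit_ball_count {G E : Type*} [NormedAddCommGroup E] [NormedSpace ℝ E]
    [FiniteDimensional ℝ E] (ψ : G → E) {C : ℝ} (hψ : CInjective ψ C) {T : ℝ} (hT : 0 ≤ T)
    (S : Finset G) (hS : ∀ a ∈ S, ‖ψ a‖ ≤ T) :
    (S.card : ℝ) ≤ C * (T + 1) ^ Module.finrank ℝ E := by
  classical
  borelize E
  let μ : Measure E := Measure.addHaar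
  have hC : 0 ≤ C := by simpa using hψ 0 ∅ (by simp)
  have hμ0 : μ (Metric.ball 0 1) ≠ 0 := (Metric.measure_ball_pos μ 0 one_pos).ne'
  have hμ1 : μ (Metric.ball 0 1) ≠ ⊤ := measure_ball_lt_top.ne
  have key : (S.card : ENNReal) * μ (Metric.ball 0 1) ≤
      ENNReal.ofReal (C * (T + 1) ^ Module.finrank ℝ E) * μ (Metric.ball 0 1) := by
    calc (S.card : ENNReal) * μ (Metric.ball 0 1)
        = ∑ a ∈ S, μ (Metric.closedBall (ψ a) 1) := by
          simp [Measure.addHaar_closedBall μ _ zero_le_one]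
      _ = ∫⁻ y, ∑ a ∈ S, (Metric.closedBall (ψ a) 1).indicator 1 y ∂μ := by
          rw [lintegral_finsetSum _ fun a _ =>
            measurable_one.indicator Metric.isClosed_closedBall.measurableSet]
          exact Finset.sum_congr rfl fun a _ =>
            (lintegral_indicator_one Metric.isClosed_closedBall.measurableSet).symm
      _ ≤ ∫⁻ y, (Metric.closedBall (0 : E) (T + 1)).indicator
            (fun _ => ENNReal.ofReal C) y ∂μ := by
          refine lintegral_mono fun y => ?_
          have hsum : ∑ a ∈ S, (Metric.closedBall (ψ a) 1).indicator (1 : E → ENNReal) y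
              = ((S.filter fun a => y ∈ Metric.closedBall (ψ a) 1).card : ENNReal) := by
            simp [Set.indicator_apply]
          rw [hsum]
          by_cases hy : y ∈ Metric.closedBall (0 : E) (T + 1)
          · rw [Set.indicator_of_mem hy, ← ENNReal.ofReal_natCast]
            refine ENNReal.ofReal_le_ofReal (hψ y _ fun a ha => ?_)
            rw [Metric.mem_closedBall_comm]
            exact (Finset.mem_filter.1 ha).2
          · rw [Set.indicator_of_notMem hy, Finset.filter_false_of_mem]
            · simp
            · intro a ha hya
              refine hy ?_
              rw [mem_closedBall_iff_norm] at hya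
              rw [mem_closedBall_zero_iff]
              have := norm_le_norm_add_norm_sub' y (ψ a)
              linarith [hS a ha]
      _ = _ := by
          rw [lintegral_indicator_const Metric.isClosed_closedBall.measurableSet,
            Measure.addHaar_closedBall μ _ (by linarith : 0 ≤ T + 1), ENNReal.ofReal_mul hC,
            mul_assoc]
  have h2 := (ENNReal.mul_le_mul_iff_left hμ0 hμ1).1 key
  rw [← ENNReal.ofReal_natCast] at h2
  exact (ENNReal.ofReal_le_ofReal_iff (by positivity)).1 h2

open MeasureTheory in
/-- If every ball of radius `ρ` centred in the ball of radius `R` about the origin contains at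
least `n` of finitely many points, then the number of points is at least
`n * (R / ρ) ^ dim E`. -/
theorem mul_pow_le_card_mul_pow {G E : Type*} [NormedAddCommGroup E] [NormedSpace ℝ E]
    [FiniteDimensional ℝ E] (ψ : G → E) {ρ R : ℝ} (hρ : 0 ≤ ρ) (hR : 0 ≤ R) (n : ℕ) (S : Finset G)
    (hS : ∀ y : E, ‖y‖ ≤ R → ∃ F ⊆ S, n ≤ F.card ∧ ∀ a ∈ F, ‖ψ a - y‖ ≤ ρ) :
    n * R ^ Module.finrank ℝ E ≤ S.card * ρ ^ Module.finrank ℝ E := by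
  classical
  borelize E
  let μ : Measure E := Measure.addHaar
  have hμ0 : μ (Metric.ball 0 1) ≠ 0 := (Metric.measure_ball_pos μ 0 one_pos).ne'
  have hμ1 : μ (Metric.ball 0 1) ≠ ⊤ := measure_ball_lt_top.ne
  have key : ENNReal.ofReal (n * R ^ Module.finrank ℝ E) * μ (Metric.ball 0 1) ≤
      ENNReal.ofReal (S.card * ρ ^ Module.finrank ℝ E) * μ (Metric.ball 0 1) := by
    calc _ = ∫⁻ y, (Metric.closedBall (0 : E) R).indicator (fun _ => (n : ENNReal)) y ∂μ := by
          rw [lintegral_indicator_const Metric.isClosed_closedBall.measurableSet,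
            Measure.addHaar_closedBall μ _ hR, ENNReal.ofReal_mul (by positivity), mul_assoc,
            ENNReal.ofReal_natCast]
      _ ≤ ∫⁻ y, ∑ a ∈ S, (Metric.closedBall (ψ a) ρ).indicator 1 y ∂μ := by
          refine lintegral_mono fun y => ?_
          have hsum : ∑ a ∈ S, (Metric.closedBall (ψ a) ρ).indicator (1 : E → ENNReal) y
              = ((S.filter fun a => y ∈ Metric.closedBall (ψ a) ρ).card : ENNReal) := by
            simp [Set.indicator_apply]
          rw [hsum]
          by_cases hy : y ∈ Metric.closedBall (0 : E) R
          · rw [Set.indicator_of_mem hy]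
            obtain ⟨F, hFS, hn, hF⟩ := hS y (mem_closedBall_zero_iff.1 hy)
            refine Nat.cast_le.2 (hn.trans (Finset.card_le_card fun a ha => ?_))
            rw [Finset.mem_filter, Metric.mem_closedBall_comm, mem_closedBall_iff_norm]
            exact ⟨hFS ha, hF a ha⟩
          · rw [Set.indicator_of_notMem hy]
            exact zero_le
      _ = ∑ a ∈ S, μ (Metric.closedBall (ψ a) ρ) := by
          rw [lintegral_finsetSum _ fun a _ =>
            measurable_one.indicator Metric.isClosed_closedBall.measurableSet]
          exact Finset.sum_congr rfl fun a _ =>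
            lintegral_indicator_one Metric.isClosed_closedBall.measurableSet
      _ = _ := by
          rw [ENNReal.ofReal_mul (by positivity), ENNReal.ofReal_natCast, mul_assoc]
          simp [Measure.addHaar_closedBall μ _ hρ]
  have h2 := (ENNReal.mul_le_mul_iff_left hμ0 hμ1).1 key
  exact (ENNReal.ofReal_le_ofReal_iff (by positivity)).1 h2

open Filter Topology in
/-- If unit balls contain at most `C` points and balls of radius `ρ` contain at least `n` points,
then `n ≤ ρ ^ dim E * C`. -/
theorem natCast_le_pow_mul_of_ball_counts {G E : Type*} [NormedAddCommGroup E] [NormedSpace ℝ E]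
    [FiniteDimensional ℝ E] (ψ : G → E) {C ρ : ℝ} (hψ : CInjective ψ C) (hρ : 0 ≤ ρ) (n : ℕ)
    (hn : ∀ y : E, ∃ F : Finset G, n ≤ F.card ∧ ∀ a ∈ F, ‖ψ a - y‖ ≤ ρ) :
    (n : ℝ) ≤ ρ ^ Module.finrank ℝ E * C := by
  set r := Module.finrank ℝ E
  have hfin (T : ℝ) (hT : 0 ≤ T) : {a | ‖ψ a‖ ≤ T}.Finite := by
    by_contra hinf
    obtain ⟨k, hk⟩ := exists_nat_gt (C * (T + 1) ^ r)
    obtain ⟨S, hS, hcard⟩ := Set.Infinite.exists_subset_card_eq hinf k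
    have := card_le_of_unit_ball_count ψ hψ hT S fun a ha => hS ha
    rw [hcard] at this
    exact absurd hk this.not_gt
  have hbound : ∀ R : ℝ, 0 < R → (n : ℝ) ≤ ρ ^ r * C * (1 + (ρ + 1) / R) ^ r := by
    intro R hR
    have hT : 0 ≤ R + ρ := by positivity
    let S := (hfin (R + ρ) hT).toFinset
    have h1 := card_le_of_unit_ball_count ψ hψ hT S fun a ha => by simpa [S] using ha
    have h2 := mul_pow_le_card_mul_pow ψ hρ hR.le n S fun y hy => by
      obtain ⟨F, hF, hFy⟩ := hn y
      refine ⟨F, fun a ha => ?_, hF, hFy⟩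
      have := norm_le_norm_add_norm_sub' (ψ a) y
      have := hFy a ha
      simp only [S, Set.Finite.mem_toFinset, Set.mem_ofPred_eq]
      linarith
    have h3 : n * R ^ r ≤ C * (R + ρ + 1) ^ r * ρ ^ r :=
      h2.trans (mul_le_mul_of_nonneg_right h1 (by positivity))
    have h4 : 1 + (ρ + 1) / R = (R + ρ + 1) / R := by field_simp; ring
    rw [h4, div_pow, ← mul_div_assoc, le_div_iff₀ (by positivity)]
    linarith
  have hlim : Tendsto (fun R : ℝ => ρ ^ r * C * (1 + (ρ + 1) / R) ^ r) atTop
      (𝓝 (ρ ^ r * C * (1 + 0) ^ r)) :=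
    ((tendsto_const_nhds.add (tendsto_const_nhds.div_atTop tendsto_id)).pow r).const_mul _
  simpa using ge_of_tendsto hlim ((eventually_gt_atTop 0).mono hbound)

/-- Finitely generated groups are countable. -/
theorem Group.FG.countable {G : Type*} [Group G] (hG : Group.FG G) : Countable G := by
  obtain ⟨α, _, φ, hφ⟩ := Group.fg_iff_exists_freeGroup_hom_surjective_finite.1 hG
  have := Finite.to_countable (α := α)
  have : Countable (FreeGroup α) :=
    Function.Surjective.countable (f := FreeGroup.mk) Quot.mk_surjective
  exact hφ.countable

/-- A real vector space covered by a `0`-surjective map from a countable type is trivial. -/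
theorem CSurjective.subsingleton_of_zero {A V : Type*} [Countable A] [NormedAddCommGroup V]
    [NormedSpace ℝ V] {φ : A → V} (h : CSurjective φ 0) : Subsingleton V := by
  have hsurj : Function.Surjective φ := fun v => by
    obtain ⟨a, ha⟩ := h v
    exact ⟨a, sub_eq_zero.1 (norm_le_zero_iff.1 ha)⟩
  have hV : Countable V := hsurj.countable
  by_contra hns
  rw [not_subsingleton_iff_nontrivial] at hns
  obtain ⟨v, hv⟩ := exists_ne (0 : V)
  have : Countable ℝ := (smul_left_injective ℝ hv).countable
  exact Set.not_countable_univ (α := ℝ) Set.countable_univ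

/-- The line spanned by `v` attains, in the quotient by a subgroup, every norm up to that of
`v`. -/
theorem exists_norm_mk_smul_eq {V : Type*} [NormedAddCommGroup V] [NormedSpace ℝ V]
    (L : AddSubgroup V) (v : V) {d : ℝ} (hd : 0 ≤ d) (hdv : d ≤ ‖(v : V ⧸ L)‖) :
    ∃ t : ℝ, ‖((t • v : V) : V ⧸ L)‖ = d := by
  have hcont : Continuous fun t : ℝ => ‖((t • v : V) : V ⧸ L)‖ :=
    continuous_norm.comp (continuous_quot_mk.comp (continuous_id.smul continuous_const))
  obtain ⟨t, -, ht⟩ := intermediate_value_Icc zero_le_one hcont.continuousOn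
    (show d ∈ Set.Icc _ _ by simpa using ⟨hd, hdv⟩)
  exact ⟨t, ht⟩

/-- Every point of `ker m` is within `3 * C ^ (rk m + 1) * D` of the image of `ker f`, provided the
vertical maps `φ` and `ψ` are `C`-surjective and `D`-injective respectively. -/
theorem exists_mem_ker_norm_sub_le {A B V W : Type*} [Group A] [Countable A] [Group B]
    [NormedAddCommGroup V] [NormedSpace ℝ V]
    [NormedAddCommGroup W] [NormedSpace ℝ W] [FiniteDimensional ℝ W]
    (f : A →* B) (m : V →ₗ[ℝ] W) (φ : A → V) (ψ : B → W)
    (hφ : ∀ a b, φ (a * b) = φ a + φ b) (hcomm : ∀ a, m (φ a) = ψ (f a))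
    (hm : ∀ v, ‖m v‖ ≤ ‖v‖) {C D : ℝ} (hC : CSurjective φ C) (hD : CInjective ψ D)
    {v : V} (hv : m v = 0) :
    ∃ a, f a = 1 ∧ ‖φ a - v‖ ≤ 3 * C ^ (Module.finrank ℝ (LinearMap.range m) + 1) * D := by
  classical
  have hφ1 : φ 1 = 0 := by simpa using hφ 1 1
  have hφinv (a : A) : φ a⁻¹ = -φ a := by
    rw [eq_neg_iff_add_eq_zero, ← hφ, inv_mul_cancel, hφ1]
  have hC0 : 0 ≤ C := by
    obtain ⟨a, ha⟩ := hC 0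
    exact (norm_nonneg _).trans ha
  have hD0 : 0 ≤ D := by simpa using hD 0 ∅ (by simp)
  rcases hC0.eq_or_lt with rfl | hCpos
  · have := hC.subsingleton_of_zero
    exact ⟨1, map_one f, by simp [Subsingleton.elim (φ 1 - v) 0]⟩
  by_contra! hfar
  set Q := C ^ Module.finrank ℝ (LinearMap.range m) * D with hQ
  have hQ0 : 0 ≤ Q := by positivity
  let L : AddSubgroup V :=
    { carrier := {x | ∃ a, f a = 1 ∧ φ a = x}
      zero_mem' := ⟨1, map_one f, hφ1⟩
      add_mem' := by
        rintro _ _ ⟨a, ha, rfl⟩ ⟨b, hb, rfl⟩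
        exact ⟨a * b, by simp [ha, hb], hφ a b⟩
      neg_mem' := by
        rintro _ ⟨a, ha, rfl⟩
        exact ⟨a⁻¹, by simp [ha], hφinv a⟩ }
  have hvL : 3 * C * Q ≤ ‖(v : V ⧸ L)‖ := by
    rw [QuotientAddGroup.norm_mk]
    refine (Metric.le_infDist ⟨0, L.zero_mem⟩).2 ?_
    rintro _ ⟨a, ha, rfl⟩
    rw [dist_comm, dist_eq_norm]
    have := hfar a ha
    rw [hQ]
    calc _ = _ := by ring
      _ ≤ _ := this.le
  have hpts (j : Fin (⌊Q⌋₊ + 1)) : ∃ t : ℝ, ‖((t • v : V) : V ⧸ L)‖ = 3 * C * (j : ℕ) := by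
    refine exists_norm_mk_smul_eq L v (by positivity) (le_trans ?_ hvL)
    have : ((j : ℕ) : ℝ) ≤ Q :=
      (Nat.cast_le.2 (Nat.lt_succ_iff.1 j.2)).trans (Nat.floor_le hQ0)
    gcongr
  choose t ht using hpts
  let G := {b : B // ψ b ∈ LinearMap.range m}
  let χ : G → LinearMap.range m := fun b => ⟨ψ b, b.2⟩
  have hχ : CInjective χ D := by
    intro x S hS
    rw [← Finset.card_map (Function.Embedding.subtype _)]
    refine hD x _ fun b hb => ?_
    obtain ⟨g, hg, rfl⟩ := Finset.mem_map.1 hb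
    exact hS g hg
  have hcount : ((⌊Q⌋₊ + 1 : ℕ) : ℝ) ≤ Q := by
    refine natCast_le_pow_mul_of_ball_counts χ hχ hC0 _ ?_
    rintro ⟨_, w, rfl⟩
    choose a ha using fun j => hC (t j • v + w)
    let g : Fin (⌊Q⌋₊ + 1) → G := fun j => ⟨f (a j), φ (a j), hcomm _⟩
    have hle : ∀ i j, f (a i) = f (a j) →
        ‖((t i • v : V) : V ⧸ L)‖ ≤ ‖((t j • v : V) : V ⧸ L)‖ + 2 * C := by
      intro i j hij
      have hmem : φ (a i) - φ (a j) ∈ L :=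
        ⟨a i * (a j)⁻¹, by simp [hij], by rw [hφ, hφinv, sub_eq_add_neg]⟩
      have heq : ((t i • v : V) : V ⧸ L) = ((t j • v : V) : V ⧸ L) +
          (((φ (a j) - (t j • v + w)) - (φ (a i) - (t i • v + w)) : V) : V ⧸ L) := by
        rw [← QuotientAddGroup.mk_add, QuotientAddGroup.eq]
        convert L.neg_mem hmem using 1
        abel
      rw [heq]
      refine (norm_add_le _ _).trans (add_le_add_right ?_ _)
      refine (QuotientAddGroup.norm_mk_le_norm).trans ((norm_sub_le _ _).trans ?_)
      linarith [ha i, ha j]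
    have hinj : Function.Injective g := by
      intro i j hij
      have hf : f (a i) = f (a j) := congrArg Subtype.val hij
      have h1 := hle i j hf
      have h2 := hle j i hf.symm
      rw [ht, ht] at h1 h2
      have h3 : ((i : ℕ) : ℝ) < (j : ℕ) + 1 := by nlinarith
      have h4 : ((j : ℕ) : ℝ) < (i : ℕ) + 1 := by nlinarith
      norm_cast at h3 h4
      ext
      omega
    refine ⟨Finset.univ.image g, by rw [Finset.card_image_of_injective _ hinj]; simp, ?_⟩
    intro b hb
    obtain ⟨j, -, rfl⟩ := Finset.mem_image.1 hb
    change ‖ψ (f (a j)) - m w‖ ≤ C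
    have : ψ (f (a j)) - m w = m (φ (a j) - (t j • v + w)) := by
      simp [hcomm, hv]
    rw [this]
    exact (hm _).trans (ha j)
  push_cast at hcount
  exact absurd (Nat.lt_floor_add_one Q) hcount.not_gt

theorem quantitative_surjectivity_four_lemma
    {A₁ A₂ A₃ A₄ : Type*} [Group A₁] [Group A₂] [Group A₃] [Group A₄]
    (hA₁ : Group.FG A₁) (hA₂ : Group.FG A₂) (hA₃ : Group.FG A₃) (hA₄ : Group.FG A₄)
    {V₁ V₂ V₃ V₄ : Type*}
    [NormedAddCommGroup V₁] [NormedSpace ℝ V₁] [FiniteDimensional ℝ V₁]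
    [NormedAddCommGroup V₂] [NormedSpace ℝ V₂] [FiniteDimensional ℝ V₂]
    [NormedAddCommGroup V₃] [NormedSpace ℝ V₃] [FiniteDimensional ℝ V₃]
    [NormedAddCommGroup V₄] [NormedSpace ℝ V₄] [FiniteDimensional ℝ V₄]
    (f₁ : A₁ →* A₂) (f₂ : A₂ →* A₃) (f₃ : A₃ →* A₄)
    (m₁ : V₁ →ₗ[ℝ] V₂) (m₂ : V₂ →ₗ[ℝ] V₃) (m₃ : V₃ →ₗ[ℝ] V₄)
    (φ₁ : A₁ → V₁) (φ₂ : A₂ → V₂) (φ₃ : A₃ → V₃) (φ₄ : A₄ → V₄)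
    (hφ₁ : ∀ a b, φ₁ (a * b) = φ₁ a + φ₁ b)
    (hφ₂ : ∀ a b, φ₂ (a * b) = φ₂ a + φ₂ b)
    (hφ₃ : ∀ a b, φ₃ (a * b) = φ₃ a + φ₃ b)
    (hφ₄ : ∀ a b, φ₄ (a * b) = φ₄ a + φ₄ b)
    (hcomm₁ : ∀ a, m₁ (φ₁ a) = φ₂ (f₁ a))
    (hcomm₂ : ∀ a, m₂ (φ₂ a) = φ₃ (f₂ a))
    (hcomm₃ : ∀ a, m₃ (φ₃ a) = φ₄ (f₃ a))
    (hexA₁ : ∀ a, (∃ x, f₁ x = a) ↔ f₂ a = 1)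
    (hexA₂ : ∀ a, (∃ x, f₂ x = a) ↔ f₃ a = 1)
    (hexV₁ : LinearMap.range m₁ = LinearMap.ker m₂)
    (hexV₂ : LinearMap.range m₂ = LinearMap.ker m₃)
    (hm₁ : ∀ v, ‖m₁ v‖ ≤ ‖v‖) (hm₃ : ∀ v, ‖m₃ v‖ ≤ ‖v‖)
    {τ : ℝ} (hτ : 0 ≤ τ)
    (hτ₂ : ∀ v ∈ LinearMap.range m₂, ∃ u, m₂ u = v ∧ ‖u‖ ≤ τ * ‖v‖)
    {C₁ C₃ C₄ : ℝ}
    (h₁ : CSurjective φ₁ C₁) (h₃ : CSurjective φ₃ C₃) (h₄ : CInjective φ₄ C₄) :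
    CSurjective φ₂
      (C₁ + 3 * τ * C₃ ^ (Module.finrank ℝ ↥(LinearMap.range m₃) + 1) * C₄) := by
  have hcount : Countable A₃ := hA₃.countable
  intro v
  have hv : m₃ (m₂ v) = 0 := by
    have : m₂ v ∈ LinearMap.ker m₃ := hexV₂ ▸ LinearMap.mem_range_self m₂ v
    exact this
  obtain ⟨a₃, ha₃, hclose⟩ :=
    exists_mem_ker_norm_sub_le f₃ m₃ φ₃ φ₄ hφ₃ hcomm₃ hm₃ h₃ h₄ hv
  obtain ⟨a₂, rfl⟩ := (hexA₂ a₃).2 ha₃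
  rw [← hcomm₂, ← map_sub] at hclose
  obtain ⟨u, hu, hunorm⟩ := hτ₂ _ (LinearMap.mem_range_self m₂ (φ₂ a₂ - v))
  have hker : v - φ₂ a₂ + u ∈ LinearMap.range m₁ := by
    rw [hexV₁, LinearMap.mem_ker, map_add, hu, ← map_add]
    simp
  obtain ⟨w, hw⟩ := hker
  obtain ⟨a₁, ha₁⟩ := h₁ w
  refine ⟨f₁ a₁ * a₂, ?_⟩
  have heq : φ₂ (f₁ a₁ * a₂) - v = m₁ (φ₁ a₁ - w) + u := by
    rw [hφ₂, map_sub, hw, hcomm₁]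
    abel
  rw [heq]
  calc ‖m₁ (φ₁ a₁ - w) + u‖ ≤ ‖m₁ (φ₁ a₁ - w)‖ + ‖u‖ := norm_add_le _ _
    _ ≤ C₁ + τ * (3 * C₃ ^ (Module.finrank ℝ (LinearMap.range m₃) + 1) * C₄) :=
      add_le_add ((hm₁ _).trans ha₁) (hunorm.trans (mul_le_mul_of_nonneg_left hclose hτ))
    _ = _ := by ring
end

section
/- Let f₂ : A₂ → A₃ and f₃ : A₃ → A₄ be homomorphisms of groups with the image of f₂ equal to the kernel of f₃, let m₂ : V₂ → V₃ and m₃ : V₃ → V₄ be linear maps of finite-dimensional normed real vector spaces with m₃ ∘ m₂ = 0 and with the operator norm of m₃ at most 1, and let φᵢ : Aᵢ → Vᵢ (i = 2, 3, 4) be homomorphisms into the additive groups of the Vᵢ satisfying m₂ ∘ φ₂ = φ₃ ∘ f₂ and m₃ ∘ φ₃ = φ₄ ∘ f₃. Suppose φ₃ is C₃-surjective and φ₄ is C₄-injective, with C₃ ≥ 1 and C₄ ≥ 1. Then for every v ∈ V₂ there exists b ∈ A₂ such that ‖m₂(v − φ₂(b))‖ ≤ 3 · C₃^{rk m₃ +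 1} · C₄, where rk m₃ denotes the dimension of the image of m₃. -/
open MeasureTheory Metric in
/-- A map from `P` to a normed space that takes values in each ball of radius `1` at most `K` times
takes values in a ball of radius `s` at most `(s + 1) ^ dim * K` times. -/
theorem card_le_of_mem_closedBall {P E : Type*} [NormedAddCommGroup E] [NormedSpace ℝ E]
    [FiniteDimensional ℝ E] {g : P → E} {K : ℝ} (hK : 0 ≤ K) (hg : CInjective g K)
    {s : ℝ} (hs : 0 ≤ s) (T : Finset P) (hT : ∀ p ∈ T, g p ∈ closedBall 0 s) :
    (T.card : ℝ) ≤ (s + 1) ^ Module.finrank ℝ E * K := by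
  classical
  let _ : MeasurableSpace E := borel E
  have : BorelSpace E := ⟨rfl⟩
  let μ : Measure E := Measure.addHaar
  have hμ0 : μ (ball 0 1) ≠ 0 := (measure_ball_pos μ 0 one_pos).ne'
  have hμ1 : μ (ball 0 1) ≠ ⊤ := measure_ball_lt_top.ne
  have hsum (x : E) : ∑ p ∈ T, (closedBall (g p) 1).indicator (1 : E → ENNReal) x ≤
      (closedBall 0 (s + 1)).indicator (fun _ => ENNReal.ofReal K) x := by
    by_cases hx : x ∈ closedBall (0 : E) (s + 1)
    · rw [Set.indicator_of_mem hx]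
      have hcard := hg x (T.filter fun p => g p ∈ closedBall x 1) (by simp)
      calc _ = ((T.filter fun p => g p ∈ closedBall x 1).card : ENNReal) := by
            simp [Set.indicator_apply, Finset.sum_boole, dist_comm]
        _ ≤ _ := by
            rw [← ENNReal.ofReal_natCast]
            exact ENNReal.ofReal_le_ofReal hcard
    · rw [Set.indicator_of_notMem hx]
      refine (Finset.sum_eq_zero fun p hp => Set.indicator_of_notMem (fun h => hx ?_) _).le
      have h1 := hT p hp
      rw [mem_closedBall] at h h1 ⊢
      linarith [dist_triangle x (g p) 0]
  have key := lintegral_mono (μ := μ) hsum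
  rw [lintegral_finsetSum _ fun p _ => measurable_one.indicator measurableSet_closedBall,
    lintegral_indicator measurableSet_closedBall] at key
  simp only [lintegral_indicator_one measurableSet_closedBall, setLIntegral_const,
    Measure.addHaar_closedBall μ _ zero_le_one,
    Measure.addHaar_closedBall μ _ (add_nonneg hs zero_le_one), one_pow, ENNReal.ofReal_one,
    one_mul, Finset.sum_const, nsmul_eq_mul] at key
  rw [← mul_assoc, ENNReal.mul_le_mul_iff_left hμ0 hμ1, ← ENNReal.ofReal_mul hK,
    ← ENNReal.ofReal_natCast, ENNReal.ofReal_le_ofReal_iff (by positivity)] at key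
  linarith

open MeasureTheory Metric in
/-- If every ball of radius `ρ` contains the values of at least `n` elements, and every ball of
radius `1` those of at most `K` elements, then comparing densities gives `n ≤ ρ ^ dim * K`. -/
theorem le_pow_finrank_mul_of_forall_exists_card {P E : Type*} [NormedAddCommGroup E]
    [NormedSpace ℝ E] [FiniteDimensional ℝ E] {g : P → E} {K ρ : ℝ} (hK : 0 ≤ K) (hρ : 0 ≤ ρ)
    (hg : CInjective g K) (n : ℕ)
    (hn : ∀ x, ∃ S : Finset P, n ≤ S.card ∧ ∀ p ∈ S, g p ∈ closedBall x ρ) :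
    (n : ℝ) ≤ ρ ^ Module.finrank ℝ E * K := by
  classical
  let _ : MeasurableSpace E := borel E
  have : BorelSpace E := ⟨rfl⟩
  let μ : Measure E := Measure.addHaar
  have hμ0 : μ (ball 0 1) ≠ 0 := (measure_ball_pos μ 0 one_pos).ne'
  have hμ1 : μ (ball 0 1) ≠ ⊤ := measure_ball_lt_top.ne
  have bound (R : ℝ) (hR : 0 ≤ R) : n * R ^ Module.finrank ℝ E ≤
      (R + ρ + 1) ^ Module.finrank ℝ E * (ρ ^ Module.finrank ℝ E * K) := by
    have hfin : {p | g p ∈ closedBall 0 (R + ρ)}.Finite := by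
      by_contra hinf
      obtain ⟨m, hm⟩ := exists_nat_gt ((R + ρ + 1) ^ Module.finrank ℝ E * K)
      obtain ⟨T, hT, rfl⟩ := Set.Infinite.exists_subset_card_eq hinf m
      exact hm.not_ge
        (card_le_of_mem_closedBall hK hg (add_nonneg hR hρ) T fun p hp => hT hp)
    let T := hfin.toFinset
    have hT := card_le_of_mem_closedBall hK hg (add_nonneg hR hρ) T
      fun p hp => hfin.mem_toFinset.1 hp
    have hsum (x : E) : (closedBall 0 R).indicator (fun _ => (n : ENNReal)) x ≤
        ∑ p ∈ T, (closedBall (g p) ρ).indicator (1 : E → ENNReal) x := by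
      refine Set.indicator_apply_le' (fun hx => ?_) fun _ => zero_le
      obtain ⟨S, hS, hSx⟩ := hn x
      calc (n : ENNReal) ≤ ((T.filter fun p => g p ∈ closedBall x ρ).card : ENNReal) := by
            refine Nat.cast_le.2 (hS.trans (Finset.card_le_card fun p hp => ?_))
            refine Finset.mem_filter.2 ⟨hfin.mem_toFinset.2 ?_, hSx p hp⟩
            have h1 := hSx p hp
            rw [mem_closedBall] at hx h1
            rw [Set.mem_ofPred_eq, mem_closedBall]
            linarith [dist_triangle (g p) x 0]
        _ = _ := by simp [Set.indicator_apply, Finset.sum_boole, dist_comm]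
    have key := lintegral_mono (μ := μ) hsum
    rw [lintegral_finsetSum _ fun p _ => measurable_one.indicator measurableSet_closedBall,
      lintegral_indicator measurableSet_closedBall] at key
    simp only [lintegral_indicator_one measurableSet_closedBall, setLIntegral_const,
      Measure.addHaar_closedBall μ _ hρ, Measure.addHaar_closedBall μ _ hR,
      Finset.sum_const, nsmul_eq_mul] at key
    rw [← mul_assoc, ← mul_assoc, ENNReal.mul_le_mul_iff_left hμ0 hμ1, ← ENNReal.ofReal_natCast,
      ← ENNReal.ofReal_natCast, ← ENNReal.ofReal_mul (by positivity),
      ← ENNReal.ofReal_mul (by positivity), ENNReal.ofReal_le_ofReal_iff (by positivity)] at key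
    calc _ ≤ _ := key
      _ ≤ _ := mul_le_mul_of_nonneg_right hT (by positivity)
      _ = _ := by ring
  have lim : Filter.Tendsto (fun R : ℝ => (1 + (ρ + 1) / R) ^ Module.finrank ℝ E *
      (ρ ^ Module.finrank ℝ E * K)) Filter.atTop
      (nhds ((1 + 0) ^ Module.finrank ℝ E * (ρ ^ Module.finrank ℝ E * K))) :=
    ((tendsto_const_nhds.add (tendsto_const_nhds.div_atTop Filter.tendsto_id)).pow _).mul_const _
  rw [add_zero, one_pow, one_mul] at lim
  refine ge_of_tendsto lim ?_
  filter_upwards [Filter.eventually_gt_atTop 0] with R hR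
  have hpow : 0 < R ^ Module.finrank ℝ E := pow_pos hR _
  refine le_of_mul_le_mul_right ((bound R hR.le).trans_eq ?_) hpow
  rw [mul_right_comm, ← mul_pow]
  congr 2
  field_simp
  ring

theorem exists_b_with_small_m2_defect
    {A₂ A₃ A₄ : Type*} [Group A₂] [Group A₃] [Group A₄]
    {V₂ V₃ V₄ : Type*}
    [NormedAddCommGroup V₂] [NormedSpace ℝ V₂] [FiniteDimensional ℝ V₂]
    [NormedAddCommGroup V₃] [NormedSpace ℝ V₃] [FiniteDimensional ℝ V₃]
    [NormedAddCommGroup V₄] [NormedSpace ℝ V₄] [FiniteDimensional ℝ V₄]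
    (f₂ : A₂ →* A₃) (f₃ : A₃ →* A₄)
    (m₂ : V₂ →ₗ[ℝ] V₃) (m₃ : V₃ →ₗ[ℝ] V₄)
    (φ₂ : A₂ → V₂) (φ₃ : A₃ → V₃) (φ₄ : A₄ → V₄)
    (hφ₂ : ∀ a b, φ₂ (a * b) = φ₂ a + φ₂ b)
    (hφ₃ : ∀ a b, φ₃ (a * b) = φ₃ a + φ₃ b)
    (hφ₄ : ∀ a b, φ₄ (a * b) = φ₄ a + φ₄ b)
    (hexA : ∀ a, (∃ x, f₂ x = a) ↔ f₃ a = 1)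
    (hm₂₃ : ∀ v, m₃ (m₂ v) = 0)
    (hm₃ : ∀ v, ‖m₃ v‖ ≤ ‖v‖)
    (hcomm₂ : ∀ a, m₂ (φ₂ a) = φ₃ (f₂ a))
    (hcomm₃ : ∀ a, m₃ (φ₃ a) = φ₄ (f₃ a))
    {C₃ C₄ : ℝ} (hC₃ : 1 ≤ C₃) (hC₄ : 1 ≤ C₄)
    (h₃ : CSurjective φ₃ C₃) (h₄ : CInjective φ₄ C₄) :
    ∀ v : V₂, ∃ b : A₂,
      ‖m₂ (v - φ₂ b)‖ ≤ 3 * C₃ ^ (Module.finrank ℝ ↥(LinearMap.range m₃) + 1) * C₄ := by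
  intro v
  set M : ℝ := C₃ ^ Module.finrank ℝ ↥(LinearMap.range m₃) * C₄ with hM
  have hM1 : 1 ≤ M := one_le_mul_of_one_le_of_one_le (one_le_pow₀ hC₃) hC₄
  have hD : 3 * C₃ ^ (Module.finrank ℝ ↥(LinearMap.range m₃) + 1) * C₄ = 3 * C₃ * M := by
    rw [hM, pow_succ]; ring
  rw [hD]
  by_contra! hfar
  let d : ℝ := ⨅ b, ‖m₂ (v - φ₂ b)‖
  have hbdd : BddBelow (Set.range fun b => ‖m₂ (v - φ₂ b)‖) :=
    ⟨0, by rintro _ ⟨b, rfl⟩; exact norm_nonneg _⟩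
  have hd_le (b : A₂) : d ≤ ‖m₂ (v - φ₂ b)‖ := ciInf_le hbdd b
  have hd : 3 * C₃ * M ≤ d := le_ciInf fun b => (hfar b).le
  obtain ⟨b₀, hb₀⟩ : ∃ b, ‖m₂ (v - φ₂ b)‖ < d + C₃ / 2 :=
    exists_lt_of_ciInf_lt (by linarith)
  set w : V₃ := m₂ (v - φ₂ b₀)
  have hmw : m₃ w = 0 := hm₂₃ _
  -- Points of the segment `[0, w]` are about as far as possible from the image of `A₂`.
  have hdist (t : ℝ) (h0 : 0 ≤ t) (ht : t ≤ 1) (b : A₂) :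
      t * d - C₃ / 2 ≤ ‖t • w - φ₃ (f₂ b)‖ := by
    have h1 : d ≤ ‖w - φ₃ (f₂ b)‖ := by
      have := hd_le (b₀ * b)
      rwa [hφ₂, ← sub_sub, map_sub, hcomm₂ b] at this
    have h2 : ‖w - φ₃ (f₂ b)‖ ≤ ‖t • w - φ₃ (f₂ b)‖ + (1 - t) * ‖w‖ := by
      have : w - φ₃ (f₂ b) = (t • w - φ₃ (f₂ b)) + (1 - t) • w := by module
      rw [this]
      refine (norm_add_le _ _).trans_eq ?_
      rw [norm_smul, Real.norm_of_nonneg (by linarith)]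
    have h3 : (1 - t) * ‖w‖ ≤ (1 - t) * (d + C₃ / 2) :=
      mul_le_mul_of_nonneg_left hb₀.le (by linarith)
    nlinarith
  let N : ℕ := ⌊M⌋₊
  have hN1 : 1 ≤ N := Nat.one_le_floor_iff _ |>.2 hM1
  have hN : (0 : ℝ) < N := by exact_mod_cast hN1
  have hNM : (N : ℝ) ≤ M := Nat.floor_le (by linarith)
  have hdN : 3 * C₃ * N ≤ d := (mul_le_mul_of_nonneg_left hNM (by linarith)).trans hd
  let g : {p : A₄ // φ₄ p ∈ LinearMap.range m₃} → LinearMap.range m₃ := fun p => ⟨φ₄ p, p.2⟩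
  have hg : CInjective g C₄ := by
    intro x S hS
    rw [← Finset.card_map (Function.Embedding.subtype _)]
    refine h₄ x _ fun a ha => ?_
    obtain ⟨p, hp, rfl⟩ := Finset.mem_map.1 ha
    exact hS p hp
  have hcount := le_pow_finrank_mul_of_forall_exists_card (ρ := C₃) (zero_le_one.trans hC₄)
    (zero_le_one.trans hC₃) hg (N + 1) ?_
  · have := Nat.lt_floor_add_one M
    push_cast at hcount
    linarith
  rintro ⟨_, y, rfl⟩
  choose a ha using fun i : Fin (N + 1) => h₃ (((i : ℝ) / N) • w + y)
  let p (i : Fin (N + 1)) : {p : A₄ // φ₄ p ∈ LinearMap.range m₃} :=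
    ⟨f₃ (a i), φ₃ (a i), hcomm₃ _⟩
  have hne (i j : Fin (N + 1)) (hij : j < i) : p i ≠ p j := by
    intro h
    have hf : f₃ (a i) = f₃ (a j) := congrArg Subtype.val h
    obtain ⟨b, hb⟩ := (hexA (a i * (a j)⁻¹)).2 (by rw [map_mul, map_inv, hf, mul_inv_cancel])
    have hφ : φ₃ (a i) = φ₃ (f₂ b) + φ₃ (a j) := by rw [← hφ₃, hb, inv_mul_cancel_right]
    have hstep : (1 : ℝ) ≤ (i : ℝ) - j := by
      have : (j : ℝ) + 1 ≤ i := by exact_mod_cast hij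
      linarith
    have hle : (i : ℝ) - j ≤ N := by
      have : (i : ℝ) ≤ N := by exact_mod_cast Nat.lt_succ_iff.1 i.2
      have : (0 : ℝ) ≤ j := by positivity
      linarith
    have hclose : ‖(((i : ℝ) - j) / N) • w - φ₃ (f₂ b)‖ ≤ C₃ + C₃ := by
      have : (((i : ℝ) - j) / N) • w - φ₃ (f₂ b) =
          (φ₃ (a j) - (((j : ℝ) / N) • w + y)) - (φ₃ (a i) - (((i : ℝ) / N) • w + y)) := by
        rw [hφ, sub_div]; module
      rw [this]
      exact (norm_sub_le _ _).trans (add_le_add (ha j) (ha i))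
    have hlarge : 3 * C₃ ≤ ((i : ℝ) - j) / N * d := by
      rw [div_mul_eq_mul_div, le_div_iff₀ hN]
      exact hdN.trans (le_mul_of_one_le_left (le_trans (by positivity) hd) hstep)
    have := hdist (((i : ℝ) - j) / N) (div_nonneg (by linarith) hN.le) ((div_le_one hN).2 hle) b
    linarith
  have hinj : Function.Injective p := by
    intro i j h
    rcases lt_trichotomy i j with hij | hij | hij
    · exact absurd h.symm (hne j i hij)
    · exact hij
    · exact absurd h (hne i j hij)
  refine ⟨Finset.univ.map ⟨p, hinj⟩, by simp, fun q hq => ?_⟩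
  obtain ⟨i, -, rfl⟩ := Finset.mem_map.1 hq
  rw [Metric.mem_closedBall, Subtype.dist_eq, dist_eq_norm]
  have hi : φ₄ (f₃ (a i)) - m₃ y = m₃ (φ₃ (a i) - (((i : ℝ) / N) • w + y)) := by
    rw [map_sub, map_add, map_smul, hmw, smul_zero, zero_add, hcomm₃]
  exact (congrArg norm hi).trans_le ((hm₃ _).trans (ha i))
end

section
/- Pigeonhole descent step of the surjectivity four lemma: Let f₂ : A₂ → A₃ and f₃ : A₃ → A₄ be homomorphisms of groups with the image of f₂ equal to the kernel of f₃, let m₂ : V₂ → V₃ and m₃ : V₃ → V₄ be linear maps of finite-dimensional normed real vector spaces with m₃ ∘ m₂ = 0 and with the operator norm of m₃ at most 1, and let φᵢ : Aᵢ → Vᵢ (i = 2, 3, 4) be homomorphisms into the additive groups of the Vᵢ satisfying m₂ ∘ φ₂ = φ₃ ∘ f₂ and m₃ ∘ φ₃ = φ₄ ∘ f₃. Suppose φ₃ is C₃-surjective and φ₄ is C₄-injective, with C₃ ≥ 1 and C₄ ≥ 1. Then for every v ∈ V₂ with ‖m₂(v)‖ > 3 · C₃^{rk m₃ + 1} ·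 C₄ there exists b' ∈ A₂ such that ‖m₂(v − φ₂(b'))‖ ≤ ‖m₂(v)‖ − C₃, where rk m₃ denotes the dimension of the image of m₃. -/
open MeasureTheory Module in
/-- The number of points of a finite family in a ball of radius `ρ`, integrated over the centre
of the ball, is the number of points times the volume of the ball. -/
theorem lintegral_card_filter_closedBall {E ι : Type*} [NormedAddCommGroup E] [NormedSpace ℝ E]
    [FiniteDimensional ℝ E] [MeasurableSpace E] [BorelSpace E] (μ : Measure E)
    [μ.IsAddHaarMeasure] (g : ι → E) (F : Finset ι) {ρ : ℝ} (hρ : 0 ≤ ρ)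
    [∀ x, DecidablePred fun a => g a ∈ Metric.closedBall x ρ] :
    ∫⁻ x, ((F.filter fun a => g a ∈ Metric.closedBall x ρ).card : ENNReal) ∂μ
      = F.card * ENNReal.ofReal (ρ ^ finrank ℝ E) * μ (Metric.closedBall 0 1) := by
  have h (x : E) : ((F.filter fun a => g a ∈ Metric.closedBall x ρ).card : ENNReal)
      = ∑ a ∈ F, (Metric.closedBall (g a) ρ).indicator 1 x := by
    rw [Finset.card_filter]
    push_cast
    refine Finset.sum_congr rfl fun a _ => ?_
    classical
    rw [Set.indicator_apply]
    simp only [Metric.mem_closedBall, dist_comm, Pi.one_apply]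
  simp_rw [h]
  rw [lintegral_finsetSum _ fun a _ =>
    measurable_one.indicator Metric.isClosed_closedBall.measurableSet]
  have h' (a : ι) : ∫⁻ x, (Metric.closedBall (g a) ρ).indicator 1 x ∂μ
      = ENNReal.ofReal (ρ ^ finrank ℝ E) * μ (Metric.closedBall 0 1) := by
    rw [lintegral_indicator_one Metric.isClosed_closedBall.measurableSet,
      Measure.addHaar_closedBall' μ _ hρ]
  simp [h', mul_assoc]

open MeasureTheory Module in
/-- A `C`-injective map takes at most `C * (ρ + 1) ^ d` points into a ball of radius `ρ`. -/
theorem CInjective.card_le_of_mem_closedBall {E ι : Type*} [NormedAddCommGroup E]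
    [NormedSpace ℝ E] [FiniteDimensional ℝ E] {g : ι → E} {C : ℝ} (hg : CInjective g C)
    {ρ : ℝ} (hρ : 0 ≤ ρ) (F : Finset ι) (hF : ∀ a ∈ F, g a ∈ Metric.closedBall 0 ρ) :
    (F.card : ℝ) ≤ C * (ρ + 1) ^ finrank ℝ E := by
  classical
  let _ : MeasurableSpace E := borel E
  have : BorelSpace E := ⟨rfl⟩
  let μ : Measure E := Measure.addHaar
  have hC : 0 ≤ C := by simpa using hg 0 ∅ (by simp)
  have hle : ∫⁻ x, ((F.filter fun a => g a ∈ Metric.closedBall x 1).card : ENNReal) ∂μ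
      ≤ ∫⁻ x, (Metric.closedBall 0 (ρ + 1)).indicator (fun _ => ENNReal.ofReal C) x ∂μ := by
    refine lintegral_mono fun x => ?_
    by_cases hx : x ∈ Metric.closedBall (0 : E) (ρ + 1)
    · rw [Set.indicator_of_mem hx, ← ENNReal.ofReal_natCast]
      exact ENNReal.ofReal_le_ofReal (hg x _ fun a ha => (Finset.mem_filter.1 ha).2)
    · rw [Set.indicator_of_notMem hx, Finset.filter_eq_empty_iff.2]
      · simp
      · intro a ha hax
        refine hx ?_
        have := hF a ha
        rw [Metric.mem_closedBall] at this hax ⊢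
        linarith [dist_triangle x (g a) 0, dist_comm x (g a)]
  rw [lintegral_card_filter_closedBall μ g F zero_le_one,
    lintegral_indicator_const Metric.isClosed_closedBall.measurableSet,
    Measure.addHaar_closedBall' μ 0 (by positivity : 0 ≤ ρ + 1), ← mul_assoc] at hle
  have hpos : μ (Metric.closedBall 0 1) ≠ 0 := (Metric.measure_closedBall_pos μ 0 one_pos).ne'
  have htop : μ (Metric.closedBall 0 1) ≠ ⊤ := measure_closedBall_lt_top.ne
  rw [ENNReal.mul_le_mul_iff_left hpos htop, one_pow, ENNReal.ofReal_one, mul_one,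
    ← ENNReal.ofReal_natCast, ← ENNReal.ofReal_mul hC,
    ENNReal.ofReal_le_ofReal_iff (by positivity)] at hle
  exact hle

open MeasureTheory Module in
/-- If every ball of radius `R` receives at least `M` points under a `C`-injective map, then
`M ≤ R ^ d * C`: the average number of points in a ball of radius `R` is at most `R ^ d * C`. -/
theorem CInjective.le_pow_mul_of_forall_exists {E ι : Type*} [NormedAddCommGroup E]
    [NormedSpace ℝ E] [FiniteDimensional ℝ E] {g : ι → E} {C R : ℝ} (hg : CInjective g C)
    (hR : 0 ≤ R) {M : ℕ}
    (hM : ∀ p : E, ∃ S : Finset ι, M ≤ S.card ∧ ∀ a ∈ S, g a ∈ Metric.closedBall p R) :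
    (M : ℝ) ≤ R ^ finrank ℝ E * C := by
  classical
  let _ : MeasurableSpace E := borel E
  have : BorelSpace E := ⟨rfl⟩
  let μ : Measure E := Measure.addHaar
  have hpos : μ (Metric.closedBall 0 1) ≠ 0 := (Metric.measure_closedBall_pos μ 0 one_pos).ne'
  have htop : μ (Metric.closedBall 0 1) ≠ ⊤ := measure_closedBall_lt_top.ne
  have key (T : ℝ) (hT : 0 < T) :
      M * T ^ finrank ℝ E ≤ R ^ finrank ℝ E * (C * (T + R + 1) ^ finrank ℝ E) := by
    have hfin : {a | g a ∈ Metric.closedBall 0 (T + R)}.Finite := by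
      by_contra hinf
      obtain ⟨n, hn⟩ := exists_nat_gt (C * (T + R + 1) ^ finrank ℝ E)
      obtain ⟨F, hF, rfl⟩ := Set.Infinite.exists_subset_card_eq hinf n
      exact hn.not_ge (hg.card_le_of_mem_closedBall (by positivity) F fun a ha => hF ha)
    let F := hfin.toFinset
    have hFcard := hg.card_le_of_mem_closedBall (ρ := T + R) (by positivity) F fun a ha => by simpa [F] using ha
    have hle : ∫⁻ x, (Metric.closedBall 0 T).indicator (fun _ => (M : ENNReal)) x ∂μ
        ≤ ∫⁻ x, ((F.filter fun a => g a ∈ Metric.closedBall x R).card : ENNReal) ∂μ := by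
      refine lintegral_mono (Set.indicator_le fun x hx => ?_)
      obtain ⟨S, hS, hSx⟩ := hM x
      refine Nat.cast_le.2 (hS.trans (Finset.card_le_card fun a ha => ?_))
      have := hSx a ha
      refine Finset.mem_filter.2 ⟨?_, this⟩
      rw [Set.Finite.mem_toFinset, Set.mem_ofPred_eq]
      rw [Metric.mem_closedBall] at this hx ⊢
      linarith [dist_triangle (g a) x 0]
    rw [lintegral_card_filter_closedBall μ g F hR,
      lintegral_indicator_const Metric.isClosed_closedBall.measurableSet,
      Measure.addHaar_closedBall' μ _ hT.le, ← mul_assoc,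
      ENNReal.mul_le_mul_iff_left hpos htop, ← ENNReal.ofReal_natCast, ← ENNReal.ofReal_natCast,
      ← ENNReal.ofReal_mul (by positivity), ← ENNReal.ofReal_mul (by positivity),
      ENNReal.ofReal_le_ofReal_iff (by positivity), mul_comm (F.card : ℝ)] at hle
    exact hle.trans (by gcongr)
  have hlim : Filter.Tendsto
      (fun s : ℝ => R ^ finrank ℝ E * (C * (1 + (R + 1) * s) ^ finrank ℝ E))
      (nhdsWithin 0 (Set.Ioi 0)) (nhds (R ^ finrank ℝ E * C)) := by
    refine (Continuous.tendsto' (by fun_prop) 0 _ (by simp)).mono_left nhdsWithin_le_nhds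
  refine ge_of_tendsto hlim ?_
  filter_upwards [self_mem_nhdsWithin] with s hs
  have hs : 0 < s := hs
  have h := mul_le_mul_of_nonneg_right (key s⁻¹ (by positivity)) (pow_nonneg hs.le (finrank ℝ E))
  have e : s⁻¹ * s = 1 := inv_mul_cancel₀ hs.ne'
  rw [mul_assoc, mul_assoc, mul_assoc, ← mul_pow, ← mul_pow, e, one_pow, mul_one] at h
  convert h using 4
  linear_combination -e

theorem pigeonhole_descent_step
    {A₂ A₃ A₄ : Type*} [Group A₂] [Group A₃] [Group A₄]
    {V₂ V₃ V₄ : Type*}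
    [NormedAddCommGroup V₂] [NormedSpace ℝ V₂] [FiniteDimensional ℝ V₂]
    [NormedAddCommGroup V₃] [NormedSpace ℝ V₃] [FiniteDimensional ℝ V₃]
    [NormedAddCommGroup V₄] [NormedSpace ℝ V₄] [FiniteDimensional ℝ V₄]
    (f₂ : A₂ →* A₃) (f₃ : A₃ →* A₄)
    (m₂ : V₂ →ₗ[ℝ] V₃) (m₃ : V₃ →ₗ[ℝ] V₄)
    (φ₂ : A₂ → V₂) (φ₃ : A₃ → V₃) (φ₄ : A₄ → V₄)
    (hφ₂ : ∀ a b, φ₂ (a * b) = φ₂ a + φ₂ b)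
    (hφ₃ : ∀ a b, φ₃ (a * b) = φ₃ a + φ₃ b)
    (hφ₄ : ∀ a b, φ₄ (a * b) = φ₄ a + φ₄ b)
    (hexA : ∀ a, (∃ x, f₂ x = a) ↔ f₃ a = 1)
    (hm₂₃ : ∀ v, m₃ (m₂ v) = 0)
    (hm₃ : ∀ v, ‖m₃ v‖ ≤ ‖v‖)
    (hcomm₂ : ∀ a, m₂ (φ₂ a) = φ₃ (f₂ a))
    (hcomm₃ : ∀ a, m₃ (φ₃ a) = φ₄ (f₃ a))
    {C₃ C₄ : ℝ} (hC₃ : 1 ≤ C₃) (hC₄ : 1 ≤ C₄)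
    (h₃ : CSurjective φ₃ C₃) (h₄ : CInjective φ₄ C₄) :
    ∀ v : V₂,
      3 * C₃ ^ (Module.finrank ℝ ↥(LinearMap.range m₃) + 1) * C₄ < ‖m₂ v‖ →
      ∃ b' : A₂, ‖m₂ (v - φ₂ b')‖ ≤ ‖m₂ v‖ - C₃ := by
  intro v hv
  by_contra! hcon
  set r := Module.finrank ℝ ↥(LinearMap.range m₃)
  set w := m₂ v
  have hw : 0 < ‖w‖ := lt_of_le_of_lt (by positivity) hv
  have hC₃pos : 0 < C₃ := by linarith
  set M := ⌊‖w‖ / (3 * C₃)⌋₊ + 1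
  have hinj : CInjective
      (fun a : {a // φ₄ a ∈ LinearMap.range m₃} => (⟨φ₄ a, a.2⟩ : LinearMap.range m₃)) C₄ := by
    intro x S hS
    rw [← S.card_map (Function.Embedding.subtype _)]
    refine h₄ x _ fun a ha => ?_
    obtain ⟨b, hb, rfl⟩ := Finset.mem_map.1 ha
    exact hS b hb
  have hφ₃_div (a b : A₃) : φ₃ (a⁻¹ * b) = φ₃ b - φ₃ a := by
    rw [eq_sub_iff_add_eq', ← hφ₃, mul_inv_cancel_left]
  -- Equally spaced points on the segment from `0` to `w`.
  let x : ℕ → V₃ := fun k => (3 * C₃ * k / ‖w‖) • w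
  have hm₃x (k : ℕ) : m₃ (x k) = 0 := by simp [x, w, hm₂₃]
  have hM := hinj.le_pow_mul_of_forall_exists hC₃pos.le (M := M) (by
    rintro ⟨_, u, rfl⟩
    choose a ha using fun k => h₃ (x k + u)
    have hne (j k : ℕ) (hjk : j < k) (hk : k < M) : f₃ (a j) ≠ f₃ (a k) := by
      intro heq
      obtain ⟨b, hb⟩ := (hexA ((a j)⁻¹ * a k)).2 (by simp [heq])
      refine (hcon b).not_ge ?_
      have hk' : 3 * C₃ * k ≤ ‖w‖ := by
        have h := (Nat.le_floor_iff (by positivity)).1 (Nat.lt_succ_iff.1 hk)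
        rwa [le_div_iff₀ (by positivity), mul_comm] at h
      have hjk' : (j : ℝ) + 1 ≤ k := by exact_mod_cast hjk
      have hsplit : m₂ (v - φ₂ b) = (1 - 3 * C₃ * (k - j) / ‖w‖) • w
          + ((φ₃ (a j) - (x j + u)) - (φ₃ (a k) - (x k + u))) := by
        rw [map_sub, hcomm₂, hb, hφ₃_div]
        simp only [x]
        module
      have hnorm : ‖(1 - 3 * C₃ * (k - j) / ‖w‖) • w‖ = ‖w‖ - 3 * C₃ * (k - j) := by
        have h0 : 0 ≤ 1 - 3 * C₃ * (k - j) / ‖w‖ := by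
          rw [sub_nonneg, div_le_one hw]
          nlinarith [mul_nonneg hC₃pos.le (Nat.cast_nonneg (α := ℝ) j)]
        rw [norm_smul, Real.norm_of_nonneg h0]
        field_simp
      rw [hsplit]
      calc _ ≤ _ := norm_add_le _ _
        _ ≤ (‖w‖ - 3 * C₃ * (k - j)) + (C₃ + C₃) := by
          rw [hnorm]
          gcongr
          exact (norm_sub_le _ _).trans (add_le_add (ha j) (ha k))
        _ ≤ ‖w‖ - C₃ := by nlinarith
    let e : Fin M → {a // φ₄ a ∈ LinearMap.range m₃} :=
      fun k => ⟨f₃ (a k), φ₃ (a k), hcomm₃ _⟩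
    have he : Function.Injective e := by
      intro j k hjk
      have hjk : f₃ (a j) = f₃ (a k) := congrArg Subtype.val hjk
      rcases lt_trichotomy j k with h | h | h
      · exact (hne j k h k.2 hjk).elim
      · exact h
      · exact (hne k j h j.2 hjk.symm).elim
    refine ⟨Finset.univ.map ⟨e, he⟩, by simp, fun b hb => ?_⟩
    obtain ⟨k, -, rfl⟩ := Finset.mem_map.1 hb
    rw [Metric.mem_closedBall, Subtype.dist_eq, dist_eq_norm]
    change ‖φ₄ (f₃ (a k)) - m₃ u‖ ≤ C₃
    have h : φ₄ (f₃ (a k)) - m₃ u = m₃ (φ₃ (a k) - (x k + u)) := by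
      rw [map_sub, map_add, hm₃x, zero_add, hcomm₃]
    rw [h]
    exact (hm₃ _).trans (ha k))
  have hlt : ‖w‖ < M * (3 * C₃) := by
    rw [← div_lt_iff₀ (by positivity)]
    simpa [M] using Nat.lt_floor_add_one (‖w‖ / (3 * C₃))
  have hle : ‖w‖ < 3 * C₃ ^ (r + 1) * C₄ :=
    calc ‖w‖ < M * (3 * C₃) := hlt
      _ ≤ C₃ ^ r * C₄ * (3 * C₃) := by gcongr
      _ = 3 * C₃ ^ (r + 1) * C₄ := by ring
  exact hv.not_gt hle
end

section
/- For every positive integer N, the sum Σ_{a=1}^{N} Σ_{b=1}^{N} gcd(a, b) is at least (1/4) · (2 − π²/6) · N² · log N. -/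
open Finset Real

theorem sum_Icc_dvd_indicator (N m : ℕ) :
    ∑ a ∈ Icc 1 N, (if m ∣ a then (1 : ℝ) else 0) = ((N / m : ℕ) : ℝ) := by
  rw [← Finset.sum_filter, Finset.sum_const, nsmul_eq_mul, mul_one]
  exact congrArg Nat.cast (Nat.Ioc_filter_dvd_card_eq_div N m)

theorem sum_Icc_dvd_gcd_indicator (N m : ℕ) :
    ∑ a ∈ Icc 1 N, ∑ b ∈ Icc 1 N, (if m ∣ Nat.gcd a b then (1 : ℝ) else 0) =
      ((N / m : ℕ) : ℝ) ^ 2 := by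
  rw [sq, ← sum_Icc_dvd_indicator, Finset.sum_mul_sum]
  refine Finset.sum_congr rfl fun a _ => Finset.sum_congr rfl fun b _ => ?_
  simp_rw [Nat.dvd_gcd_iff, ite_and, ite_mul, one_mul, zero_mul]

/-- A proper divisor `g` of `n` has a multiple `g * l` with `l ≥ 2` that divides `n`, so only
`g = n` contributes positively to the sum on the left. -/
theorem sum_mul_dvd_indicator_sub_le {n N : ℕ} (hn : 0 < n) (hnN : n ≤ N) :
    ∑ g ∈ Icc 1 N, (g : ℝ) * ((if g ∣ n then (1 : ℝ) else 0) -
      ∑ l ∈ Icc 2 N, (if g * l ∣ n then (1 : ℝ) else 0)) ≤ n := by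
  have key : ∀ g ∈ Icc 1 N, (g : ℝ) * ((if g ∣ n then (1 : ℝ) else 0) -
      ∑ l ∈ Icc 2 N, (if g * l ∣ n then (1 : ℝ) else 0)) ≤ if g = n then (n : ℝ) else 0 := by
    intro g _
    have h0 : ∀ l ∈ Icc 2 N, (0 : ℝ) ≤ if g * l ∣ n then (1 : ℝ) else 0 := by
      intro l _; positivity
    have hs := Finset.sum_nonneg h0
    have hg0 : (0 : ℝ) ≤ g := Nat.cast_nonneg g
    split_ifs with hd he he
    · subst he
      nlinarith
    · obtain ⟨k, rfl⟩ := hd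
      have hk : k ∈ Icc 2 N := by
        have hk0 : k ≠ 0 := by rintro rfl; simp at hn
        have hk1 : k ≠ 1 := by rintro rfl; simp at he
        have := Nat.le_of_dvd hn (Dvd.intro_left g rfl)
        rw [mem_Icc]
        omega
      have h1 := Finset.single_le_sum h0 hk
      rw [if_pos dvd_rfl] at h1
      exact mul_nonpos_of_nonneg_of_nonpos hg0 (by linarith)
    · exact absurd he.dvd hd
    · exact mul_nonpos_of_nonneg_of_nonpos hg0 (by linarith)
  refine (Finset.sum_le_sum key).trans_eq ?_
  rw [Finset.sum_ite_eq' (Icc 1 N) n, if_pos (mem_Icc.2 ⟨hn, hnN⟩)]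

theorem sum_Icc_two_one_div_sq_le (N : ℕ) :
    ∑ l ∈ Icc 2 N, (1 : ℝ) / (l : ℝ) ^ 2 ≤ π ^ 2 / 6 - 1 := by
  have h := sum_le_hasSum (insert 1 (Icc 2 N)) (fun i _ => by positivity) hasSum_zeta_two
  rw [Finset.sum_insert (by simp)] at h
  norm_num at h ⊢
  linarith

theorem mul_sq_le_sq_sub_sum_div_sq (M N : ℕ) :
    (2 - π ^ 2 / 6) * (M : ℝ) ^ 2 ≤
      (M : ℝ) ^ 2 - ∑ l ∈ Icc 2 N, ((M / l : ℕ) : ℝ) ^ 2 := by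
  have h : ∑ l ∈ Icc 2 N, ((M / l : ℕ) : ℝ) ^ 2 ≤
      (M : ℝ) ^ 2 * ∑ l ∈ Icc 2 N, (1 : ℝ) / (l : ℝ) ^ 2 := by
    rw [Finset.mul_sum]
    refine Finset.sum_le_sum fun l _ => ?_
    rw [mul_one_div, ← div_pow]
    exact pow_le_pow_left₀ (Nat.cast_nonneg _) Nat.cast_div_le 2
  nlinarith [mul_le_mul_of_nonneg_left (sum_Icc_two_one_div_sq_le N) (sq_nonneg (M : ℝ))]

theorem sum_mul_sq_div_sub_le_sum_gcd (N : ℕ) :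
    ∑ g ∈ Icc 1 N, (g : ℝ) * (((N / g : ℕ) : ℝ) ^ 2 -
      ∑ l ∈ Icc 2 N, ((N / g / l : ℕ) : ℝ) ^ 2) ≤
      ∑ a ∈ Icc 1 N, ∑ b ∈ Icc 1 N, (Nat.gcd a b : ℝ) := by
  calc
    _ = ∑ a ∈ Icc 1 N, ∑ b ∈ Icc 1 N, ∑ g ∈ Icc 1 N,
          (g : ℝ) * ((if g ∣ Nat.gcd a b then (1 : ℝ) else 0) -
            ∑ l ∈ Icc 2 N, (if g * l ∣ Nat.gcd a b then (1 : ℝ) else 0)) := by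
      simp_rw [Finset.sum_comm (s := Icc 1 N) (t := Icc 1 N) (f := fun b g => (g : ℝ) * _)]
      rw [Finset.sum_comm]
      refine Finset.sum_congr rfl fun g _ => ?_
      simp_rw [← Finset.mul_sum, Finset.sum_sub_distrib, sum_Icc_dvd_gcd_indicator,
        Finset.sum_comm (s := Icc 1 N) (t := Icc 2 N), sum_Icc_dvd_gcd_indicator,
        Nat.div_div_eq_div_mul]
    _ ≤ _ := by
      refine Finset.sum_le_sum fun a ha => Finset.sum_le_sum fun b _ => ?_
      rw [mem_Icc] at ha
      exact sum_mul_dvd_indicator_sub_le (Nat.gcd_pos_of_pos_left b ha.1)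
        ((Nat.gcd_le_left b ha.1).trans ha.2)

theorem div_two_mul_le_cast_div {N g : ℕ} (hg : 0 < g) (hgN : g ≤ N) :
    (N : ℝ) / (2 * g) ≤ ((N / g : ℕ) : ℝ) := by
  have hg' : (0 : ℝ) < g := Nat.cast_pos.2 hg
  rw [div_le_iff₀ (by positivity)]
  have h1 : 1 ≤ N / g := Nat.div_pos hgN hg
  have h2 := Nat.lt_mul_div_succ N hg
  have h3 : N ≤ N / g * (2 * g) := by nlinarith
  exact_mod_cast h3

theorem sum_gcd_ge (N : ℕ) (hN : 0 < N) :
    (1 / 4 : ℝ) * (2 - π ^ 2 / 6) * (N : ℝ) ^ 2 * Real.log N ≤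
      ∑ a ∈ Icc 1 N, ∑ b ∈ Icc 1 N, (Nat.gcd a b : ℝ) := by
  have hc : 0 ≤ 2 - π ^ 2 / 6 := by
    nlinarith [Real.pi_lt_d2, Real.pi_pos]
  have hlog : Real.log N ≤ ∑ g ∈ Icc 1 N, (1 : ℝ) / g := by
    have h := log_add_one_le_harmonic N
    rw [harmonic_eq_sum_Icc] at h
    push_cast at h
    simp_rw [one_div]
    refine (Real.log_le_log (Nat.cast_pos.2 hN) ?_).trans h
    linarith
  calc
    _ ≤ (1 / 4 : ℝ) * (2 - π ^ 2 / 6) * (N : ℝ) ^ 2 * ∑ g ∈ Icc 1 N, (1 : ℝ) / g := by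
      gcongr
    _ = ∑ g ∈ Icc 1 N, (g : ℝ) * ((2 - π ^ 2 / 6) * ((N : ℝ) / (2 * g)) ^ 2) := by
      rw [Finset.mul_sum]
      refine Finset.sum_congr rfl fun g hg => ?_
      have : (g : ℝ) ≠ 0 := Nat.cast_ne_zero.2 (by rw [mem_Icc] at hg; omega)
      field_simp
      ring
    _ ≤ ∑ g ∈ Icc 1 N, (g : ℝ) * (((N / g : ℕ) : ℝ) ^ 2 -
          ∑ l ∈ Icc 2 N, ((N / g / l : ℕ) : ℝ) ^ 2) := by
      refine Finset.sum_le_sum fun g hg => ?_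
      rw [mem_Icc] at hg
      refine mul_le_mul_of_nonneg_left ?_ (Nat.cast_nonneg g)
      refine le_trans ?_ (mul_sq_le_sq_sub_sum_div_sq (N / g) N)
      have := div_two_mul_le_cast_div hg.1 hg.2
      gcongr
    _ ≤ _ := sum_mul_sq_div_sub_le_sum_gcd N
end

section
/- There exist constants c > 0 and C > 0 such that for every integer L ≥ 2, the quantity 2·L⁸ + 8·Σ_{d=1}^{L⁴−1} d + 8·Σ_{d₁=1}^{L⁴−1} Σ_{d₂=1}^{L⁴−1} gcd(d₁, d₂) is at least c · L⁸ · log L and at most C · L⁸ · log L. (This quantity counts the homotopy classes of maps (S³ × S⁴) # (S³ × S⁴) → S⁴ with degrees |dᵢ| < L⁴ on the two S⁴ factors and Hopf invariant reduced modulo 2·gcd(d₁, d₂).) -/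
open Finset

lemma sum_totient_ite_dvd_eq (N n : ℕ) (hn : n ∈ Icc 1 N) :
    ∑ e ∈ Icc 1 N, (if e ∣ n then (e.totient : ℝ) else 0) = n := by
  rw [← sum_filter]
  have h : {e ∈ Icc 1 N | e ∣ n} = n.divisors := by
    ext e
    simp only [mem_filter, mem_Icc, Nat.mem_divisors] at hn ⊢
    constructor
    · rintro ⟨-, h⟩
      exact ⟨h, by omega⟩
    · rintro ⟨h, -⟩
      have := Nat.le_of_dvd (by omega) h
      have := Nat.pos_of_dvd_of_pos h (by omega)
      exact ⟨by omega, h⟩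
  rw [h]
  exact_mod_cast n.sum_totient

lemma sum_sum_gcd_eq_sum_totient_mul_div_sq (N : ℕ) :
    ∑ a ∈ Icc 1 N, ∑ b ∈ Icc 1 N, (Nat.gcd a b : ℝ) =
      ∑ e ∈ Icc 1 N, (e.totient : ℝ) * ((N / e : ℕ) : ℝ) ^ 2 := by
  have hgcd : ∀ a ∈ Icc 1 N, ∀ b ∈ Icc 1 N, (Nat.gcd a b : ℝ) =
      ∑ e ∈ Icc 1 N, (e.totient : ℝ) * ((if e ∣ a then 1 else 0) * (if e ∣ b then 1 else 0)) := by
    intro a ha b hb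
    have hmem : Nat.gcd a b ∈ Icc 1 N := by
      simp only [mem_Icc] at *
      have := Nat.gcd_le_left b (show 0 < a by omega)
      have := Nat.gcd_pos_of_pos_left b (show 0 < a by omega)
      omega
    rw [← sum_totient_ite_dvd_eq N _ hmem]
    refine sum_congr rfl fun e _ => ?_
    by_cases h₁ : e ∣ a <;> by_cases h₂ : e ∣ b <;> simp [Nat.dvd_gcd_iff, h₁, h₂]
  have hcount (e : ℕ) : ∑ a ∈ Icc 1 N, (if e ∣ a then (1 : ℝ) else 0) = ((N / e : ℕ) : ℝ) := by
    rw [sum_boole, ← Nat.Ioc_filter_dvd_card_eq_div]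
    rfl
  rw [sum_congr rfl fun a ha => sum_congr rfl fun b hb => hgcd a ha b hb]
  rw [sum_congr rfl fun a _ => sum_comm, sum_comm]
  refine sum_congr rfl fun e _ => ?_
  rw [← hcount e, sq, sum_mul_sum, mul_sum]
  exact sum_congr rfl fun a _ => (mul_sum _ _ _).symm

lemma sum_inv_sq_Icc_le_two (N : ℕ) : ∑ m ∈ Icc 1 N, ((m : ℝ) ^ 2)⁻¹ ≤ 2 := by
  have h := sum_Ioo_inv_sq_le (α := ℝ) 0 (N + 1)
  have hset : Ioo 0 (N + 1) = Icc 1 N := by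
    ext; simp only [mem_Ioo, mem_Icc]; omega
  rw [hset] at h
  simpa using h

lemma sum_inv_sq_of_dvd_le (N e : ℕ) (he : 0 < e) :
    ∑ n ∈ Icc 1 N, (if e ∣ n then ((n : ℝ) ^ 2)⁻¹ else 0) ≤ 2 * ((e : ℝ) ^ 2)⁻¹ := by
  rw [← sum_filter]
  have hsub : {n ∈ Icc 1 N | e ∣ n} ⊆ (Icc 1 N).image (e * ·) := by
    intro n hn
    simp only [mem_filter, mem_Icc, mem_image] at hn ⊢
    obtain ⟨⟨h₁, h₂⟩, m, rfl⟩ := hn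
    exact ⟨m, ⟨Nat.pos_of_mul_pos_left h₁, (Nat.le_mul_of_pos_left m he).trans h₂⟩, rfl⟩
  calc _ ≤ ∑ n ∈ (Icc 1 N).image (e * ·), ((n : ℝ) ^ 2)⁻¹ :=
        sum_le_sum_of_subset_of_nonneg hsub fun _ _ _ => by positivity
    _ = (∑ m ∈ Icc 1 N, ((m : ℝ) ^ 2)⁻¹) * ((e : ℝ) ^ 2)⁻¹ := by
        rw [sum_image fun a _ b _ h => Nat.eq_of_mul_eq_mul_left he h, sum_mul]
        refine sum_congr rfl fun m _ => ?_
        push_cast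
        rw [mul_pow, mul_inv, mul_comm]
    _ ≤ _ := by gcongr; exact sum_inv_sq_Icc_le_two N

lemma harmonic_le_two_mul_sum_totient_div_sq (N : ℕ) :
    (harmonic N : ℝ) ≤ 2 * ∑ e ∈ Icc 1 N, (e.totient : ℝ) * ((e : ℝ) ^ 2)⁻¹ := by
  calc (harmonic N : ℝ) = ∑ n ∈ Icc 1 N, (n : ℝ) * ((n : ℝ) ^ 2)⁻¹ := by
        rw [harmonic_eq_sum_Icc]
        push_cast
        refine sum_congr rfl fun n hn => ?_
        have : (n : ℝ) ≠ 0 := by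
          simp only [mem_Icc] at hn
          exact_mod_cast (by omega : n ≠ 0)
        field_simp
    _ = ∑ e ∈ Icc 1 N, (e.totient : ℝ) *
          ∑ n ∈ Icc 1 N, (if e ∣ n then ((n : ℝ) ^ 2)⁻¹ else 0) := by
        simp_rw [mul_sum]
        rw [sum_comm]
        refine sum_congr rfl fun n hn => ?_
        rw [← sum_totient_ite_dvd_eq N n hn, sum_mul, sum_totient_ite_dvd_eq N n hn]
        refine sum_congr rfl fun e _ => ?_
        split_ifs <;> simp
    _ ≤ _ := by
        rw [mul_sum]
        refine sum_le_sum fun e he => ?_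
        rw [mul_left_comm]
        gcongr
        exact sum_inv_sq_of_dvd_le N e (mem_Icc.1 he).1

lemma sum_sum_gcd_le (N : ℕ) :
    ∑ a ∈ Icc 1 N, ∑ b ∈ Icc 1 N, (Nat.gcd a b : ℝ) ≤ (N : ℝ) ^ 2 * harmonic N := by
  rw [sum_sum_gcd_eq_sum_totient_mul_div_sq, harmonic_eq_sum_Icc]
  push_cast
  rw [mul_sum]
  refine sum_le_sum fun e he => ?_
  have he' : (0 : ℝ) < e := by exact_mod_cast (mem_Icc.1 he).1
  calc (e.totient : ℝ) * ((N / e : ℕ) : ℝ) ^ 2 ≤ (e : ℝ) * ((N : ℝ) / e) ^ 2 := by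
        gcongr
        · exact Nat.totient_le e
        · exact Nat.cast_div_le
    _ = _ := by field_simp

lemma le_sum_sum_gcd (N : ℕ) :
    (N : ℝ) ^ 2 * harmonic N ≤ 8 * ∑ a ∈ Icc 1 N, ∑ b ∈ Icc 1 N, (Nat.gcd a b : ℝ) := by
  rw [sum_sum_gcd_eq_sum_totient_mul_div_sq]
  calc (N : ℝ) ^ 2 * harmonic N
      ≤ (N : ℝ) ^ 2 * (2 * ∑ e ∈ Icc 1 N, (e.totient : ℝ) * ((e : ℝ) ^ 2)⁻¹) := by
        gcongr
        exact harmonic_le_two_mul_sum_totient_div_sq N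
    _ = 8 * ∑ e ∈ Icc 1 N, (e.totient : ℝ) * ((N : ℝ) / e / 2) ^ 2 := by
        simp_rw [mul_sum]
        refine sum_congr rfl fun e _ => ?_
        ring
    _ ≤ _ := by
        gcongr with e he
        obtain ⟨h₁, h₂⟩ := mem_Icc.1 he
        have he' : (0 : ℝ) < e := by exact_mod_cast h₁
        rw [div_div, div_le_iff₀ (by positivity)]
        have hq : 1 ≤ N / e := (Nat.one_le_div_iff h₁).2 h₂
        have hlt := Nat.lt_div_mul_add (a := N) h₁
        have : N ≤ N / e * (e * 2) := by nlinarith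
        exact_mod_cast this

theorem growth_of_maps_connected_sum_s3s4_to_s4 :
    ∃ c C : ℝ, 0 < c ∧ 0 < C ∧ ∀ L : ℕ, 2 ≤ L →
      c * (L : ℝ) ^ 8 * Real.log L ≤
        2 * (L : ℝ) ^ 8 + 8 * (∑ d ∈ Icc (1 : ℕ) (L ^ 4 - 1), (d : ℝ)) +
          8 * (∑ d₁ ∈ Icc (1 : ℕ) (L ^ 4 - 1), ∑ d₂ ∈ Icc (1 : ℕ) (L ^ 4 - 1),
            (Nat.gcd d₁ d₂ : ℝ)) ∧
      2 * (L : ℝ) ^ 8 + 8 * (∑ d ∈ Icc (1 : ℕ) (L ^ 4 - 1), (d : ℝ)) +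
          8 * (∑ d₁ ∈ Icc (1 : ℕ) (L ^ 4 - 1), ∑ d₂ ∈ Icc (1 : ℕ) (L ^ 4 - 1),
            (Nat.gcd d₁ d₂ : ℝ)) ≤
        C * (L : ℝ) ^ 8 * Real.log L := by
  refine ⟨1, 68, one_pos, by norm_num, fun L hL => ?_⟩
  have hL4 : 2 ^ 4 ≤ L ^ 4 := Nat.pow_le_pow_left hL 4
  obtain ⟨N, hN⟩ : ∃ N, L ^ 4 = N + 1 := ⟨L ^ 4 - 1, by omega⟩
  rw [hN, Nat.add_sub_cancel]
  have hNL : (L : ℝ) ^ 4 = N + 1 := by exact_mod_cast hN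
  have hL8 : (L : ℝ) ^ 8 = ((N : ℝ) + 1) ^ 2 := by rw [← hNL]; ring
  have hN15 : (15 : ℝ) ≤ N := by exact_mod_cast (by omega : 15 ≤ N)
  have hlog4 : Real.log ((N : ℝ) + 1) = 4 * Real.log L := by
    rw [← hNL, Real.log_pow]; norm_num
  have hlog : 1 / 2 ≤ Real.log L := by
    have h₁ : Real.log 2 ≤ Real.log L :=
      Real.log_le_log (by norm_num) (by exact_mod_cast hL)
    linarith [Real.log_two_gt_d9]
  have hlow : 4 * Real.log L ≤ (harmonic N : ℝ) := by
    have := log_add_one_le_harmonic N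
    push_cast at this
    linarith
  have hup : (harmonic N : ℝ) ≤ 1 + 4 * Real.log L := by
    have h₁ := harmonic_le_one_add_log N
    have h₂ : Real.log N ≤ Real.log ((N : ℝ) + 1) :=
      Real.log_le_log (by linarith) (by linarith)
    linarith
  have hsum₀ : 0 ≤ ∑ d ∈ Icc 1 N, (d : ℝ) := sum_nonneg fun d _ => d.cast_nonneg
  have hsum : ∑ d ∈ Icc 1 N, (d : ℝ) ≤ (N : ℝ) ^ 2 := by
    have := sum_le_card_nsmul (Icc 1 N) (fun d => (d : ℝ)) N
      fun d hd => by exact_mod_cast (mem_Icc.1 hd).2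
    simpa [sq] using this
  have hge := le_sum_sum_gcd N
  have hle := sum_sum_gcd_le N
  have hsq : (N : ℝ) ^ 2 ≤ ((N : ℝ) + 1) ^ 2 := by gcongr; linarith
  rw [hL8]
  constructor
  · have h₁ : (N : ℝ) ^ 2 * (4 * Real.log L) ≤ (N : ℝ) ^ 2 * harmonic N := by gcongr
    have h₂ : ((N : ℝ) + 1) ^ 2 * Real.log L ≤ 4 * (N : ℝ) ^ 2 * Real.log L := by
      gcongr
      nlinarith
    nlinarith [sq_nonneg ((N : ℝ) + 1)]
  · have h₁ : (N : ℝ) ^ 2 * harmonic N ≤ ((N : ℝ) + 1) ^ 2 * (1 + 4 * Real.log L) :=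
      mul_le_mul hsq hup (by linarith) (by positivity)
    have h₂ : ((N : ℝ) + 1) ^ 2 * (1 / 2) ≤ ((N : ℝ) + 1) ^ 2 * Real.log L := by gcongr
    linarith
end
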